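/- (Theorem 1, bound) Let m ≥ 1 and H ≥ 1 be integers. Let V_0 ∈ ℝ^S and define iterates V_{k+1} = T_{μ_{k+1},ν_{k+1}}^m(T^{H−1}V_k), where for each k the pair (μ_{k+1},ν_{k+1}) is an H-step lookahead policy for V_k. Then for every k ≥ 0, ‖V_k − J*‖_∞ ≤ (α^{H−1} + (1+α^m)·(α^{H−1}/(1−α))·(1+α))^k · ‖V_0 − J*‖_∞. -/

import Mathlib

open Finset Filter Topology Matrix

noncomputable section

/-- The probability simplex over a finite subset `D` of actions: nonnegative
weights summing to one over `D` and vanishing outside `D`. -/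
def simplex {A : Type*} [Fintype A] (D : Finset A) : Set (A → ℝ) :=
  {p | (∀ a, 0 ≤ p a) ∧ (∑ a ∈ D, p a = 1) ∧ ∀ a ∉ D, p a = 0}

/-- A finite two-player zero-sum discounted Markov game. `S` is the state space,
`A` the maximizer's global action type, `B` the minimizer's global action type. -/
structure MarkovGame (S A B : Type*) [Fintype S] [Fintype A] [Fintype B] where
  U : S → Finset A
  W : S → Finset B
  U_nonempty : ∀ s, (U s).Nonempty
  W_nonempty : ∀ s, (W s).Nonempty
  P : S → A → B → S → ℝ
  P_nonneg : ∀ s u v s', 0 ≤ P s u v s'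
  P_sum : ∀ s, ∀ u ∈ U s, ∀ v ∈ W s, ∑ s', P s u v s' = 1
  g : S → A → B → ℝ
  g_nonneg : ∀ s u v, 0 ≤ g s u v
  g_le_one : ∀ s u v, g s u v ≤ 1
  α : ℝ
  α_pos : 0 < α
  α_lt_one : α < 1

namespace MarkovGame

variable {S A B : Type*} [Fintype S] [Fintype A] [Fintype B]

/-- The state-action value matrix `A_{V,s}(u,v) = g(s,u,v) + α Σ_{s'} P(s'|s,u,v) V(s')`. -/
def Aval (G : MarkovGame S A B) (V : S → ℝ) (s : S) (u : A) (v : B) : ℝ :=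
  G.g s u v + G.α * ∑ s', G.P s u v s' * V s'

/-- A policy pair assigns to each state probability vectors over the available actions. -/
def IsPolicy (G : MarkovGame S A B) (μ : S → A → ℝ) (ν : S → B → ℝ) : Prop :=
  ∀ s, μ s ∈ simplex (G.U s) ∧ ν s ∈ simplex (G.W s)

/-- The Bellman operator of a policy pair: `(T_{μ,ν}V)(s) = μ(s)ᵀ A_{V,s} ν(s)`. -/
def Tpol (G : MarkovGame S A B) (μ : S → A → ℝ) (ν : S → B → ℝ) (V : S → ℝ) : S → ℝ :=
  fun s => ∑ u ∈ G.U s, ∑ v ∈ G.W s, μ s u * ν s v * G.Aval V s u v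

/-- The Bellman optimality operator:
`(TV)(s) = max_{p ∈ Δ(U(s))} min_{q ∈ Δ(V(s))} pᵀ A_{V,s} q`. -/
def T (G : MarkovGame S A B) (V : S → ℝ) : S → ℝ :=
  fun s => sSup {x | ∃ p ∈ simplex (G.U s),
    x = sInf {y | ∃ q ∈ simplex (G.W s),
      y = ∑ u ∈ G.U s, ∑ v ∈ G.W s, p u * q v * G.Aval V s u v}}

/-- The transition matrix `P_{μ,ν}` of a policy pair. -/
def Ppol (G : MarkovGame S A B) (μ : S → A → ℝ) (ν : S → B → ℝ) : Matrix S S ℝ :=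
  Matrix.of fun s s' => ∑ u ∈ G.U s, ∑ v ∈ G.W s, μ s u * ν s v * G.P s u v s'

/-- The expected one-step reward `g_{μ,ν}` of a policy pair. -/
def gpol (G : MarkovGame S A B) (μ : S → A → ℝ) (ν : S → B → ℝ) : S → ℝ :=
  fun s => ∑ u ∈ G.U s, ∑ v ∈ G.W s, μ s u * ν s v * G.g s u v

/-- `(μ,ν)` is an `H`-step lookahead policy for `V` if it is a policy pair and
`T_{μ,ν}(T^{H-1}V) = T^H V`. -/
def IsLookahead (G : MarkovGame S A B) (H : ℕ) (μ : S → A → ℝ) (ν : S → B → ℝ)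
    (V : S → ℝ) : Prop :=
  G.IsPolicy μ ν ∧ G.Tpol μ ν (G.T^[H - 1] V) = G.T^[H] V

end MarkovGame
section Extrema

variable {ι : Type*} {s : Set ι} {f g : ι → ℝ} {c : ℝ}

theorem sSup_le_sSup_add (hs : s.Nonempty) (hg : ∃ C, ∀ i ∈ s, g i ≤ C)
    (h : ∀ i ∈ s, f i ≤ g i + c) :
    sSup {x | ∃ i ∈ s, x = f i} ≤ sSup {x | ∃ i ∈ s, x = g i} + c := by
  obtain ⟨C, hC⟩ := hg
  obtain ⟨i₀, hi₀⟩ := hs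
  refine csSup_le ⟨f i₀, i₀, hi₀, rfl⟩ ?_
  rintro _ ⟨i, hi, rfl⟩
  have hbdd : BddAbove {x | ∃ i ∈ s, x = g i} := ⟨C, by rintro _ ⟨j, hj, rfl⟩; exact hC j hj⟩
  linarith [h i hi, le_csSup hbdd ⟨i, hi, rfl⟩]

theorem sInf_le_sInf_add (hs : s.Nonempty) (hf : ∃ C, ∀ i ∈ s, C ≤ f i)
    (h : ∀ i ∈ s, f i ≤ g i + c) :
    sInf {x | ∃ i ∈ s, x = f i} ≤ sInf {x | ∃ i ∈ s, x = g i} + c := by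
  obtain ⟨C, hC⟩ := hf
  obtain ⟨i₀, hi₀⟩ := hs
  rw [← sub_le_iff_le_add]
  refine le_csInf ⟨g i₀, i₀, hi₀, rfl⟩ ?_
  rintro _ ⟨i, hi, rfl⟩
  have hbdd : BddBelow {x | ∃ i ∈ s, x = f i} := ⟨C, by rintro _ ⟨j, hj, rfl⟩; exact hC j hj⟩
  linarith [h i hi, csInf_le hbdd ⟨i, hi, rfl⟩]

end Extrema

theorem simplex_nonempty {A : Type*} [Fintype A] {D : Finset A} (hD : D.Nonempty) :
    (simplex D).Nonempty := by
  classical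
  obtain ⟨a, ha⟩ := hD
  refine ⟨Pi.single a 1, fun b => ?_, ?_, fun b hb => ?_⟩
  · by_cases h : b = a
    · subst h; simp
    · simp [h]
  · simp [Pi.single_apply, ha]
  · have : b ≠ a := fun h => hb (h ▸ ha)
    simp [this]

theorem abs_bilinear_le {A B : Type*} [Fintype A] [Fintype B] {D : Finset A} {E : Finset B}
    {p : A → ℝ} {q : B → ℝ} (hp : p ∈ simplex D) (hq : q ∈ simplex E) {M : A → B → ℝ} {c : ℝ}
    (hM : ∀ u ∈ D, ∀ v ∈ E, |M u v| ≤ c) :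
    |∑ u ∈ D, ∑ v ∈ E, p u * q v * M u v| ≤ c := by
  calc |∑ u ∈ D, ∑ v ∈ E, p u * q v * M u v|
      ≤ ∑ u ∈ D, ∑ v ∈ E, |p u * q v * M u v| :=
        (Finset.abs_sum_le_sum_abs _ _).trans
          (Finset.sum_le_sum fun _ _ => Finset.abs_sum_le_sum_abs _ _)
    _ ≤ ∑ u ∈ D, ∑ v ∈ E, p u * q v * c := by
        refine Finset.sum_le_sum fun u hu => Finset.sum_le_sum fun v hv => ?_
        have hpq := mul_nonneg (hp.1 u) (hq.1 v)
        rw [abs_mul, abs_of_nonneg hpq]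
        exact mul_le_mul_of_nonneg_left (hM u hu v hv) hpq
    _ = c := by
        simp_rw [← Finset.sum_mul, ← Finset.mul_sum]
        rw [hq.2.1]
        simp [hp.2.1]

namespace MarkovGame

variable {S A B : Type*} [Fintype S] [Fintype A] [Fintype B] (G : MarkovGame S A B)

theorem abs_Aval_sub_le (V V' : S → ℝ) (s : S) {u : A} (hu : u ∈ G.U s) {v : B}
    (hv : v ∈ G.W s) : |G.Aval V s u v - G.Aval V' s u v| ≤ G.α * dist V V' := by
  have h : G.Aval V s u v - G.Aval V' s u v = G.α * ∑ s', G.P s u v s' * (V s' - V' s') := by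
    simp only [Aval, mul_sub, Finset.sum_sub_distrib]
    ring
  rw [h, abs_mul, abs_of_pos G.α_pos]
  refine mul_le_mul_of_nonneg_left ?_ G.α_pos.le
  calc |∑ s', G.P s u v s' * (V s' - V' s')|
      ≤ ∑ s', |G.P s u v s' * (V s' - V' s')| := Finset.abs_sum_le_sum_abs _ _
    _ ≤ ∑ s', G.P s u v s' * dist V V' := by
        refine Finset.sum_le_sum fun s' _ => ?_
        rw [abs_mul, abs_of_nonneg (G.P_nonneg s u v s'), ← Real.dist_eq]
        exact mul_le_mul_of_nonneg_left (dist_le_pi_dist V V' s') (G.P_nonneg s u v s')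
    _ = dist V V' := by rw [← Finset.sum_mul, G.P_sum s u hu v hv, one_mul]

theorem abs_bilinear_Aval_sub_le (V V' : S → ℝ) (s : S) {p : A → ℝ} {q : B → ℝ}
    (hp : p ∈ simplex (G.U s)) (hq : q ∈ simplex (G.W s)) :
    |∑ u ∈ G.U s, ∑ v ∈ G.W s, p u * q v * G.Aval V s u v -
      ∑ u ∈ G.U s, ∑ v ∈ G.W s, p u * q v * G.Aval V' s u v| ≤ G.α * dist V V' := by
  simp_rw [← Finset.sum_sub_distrib, ← mul_sub]
  exact abs_bilinear_le hp hq fun u hu v hv => G.abs_Aval_sub_le V V' s hu hv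

theorem exists_abs_bilinear_Aval_le (V : S → ℝ) (s : S) :
    ∃ C, ∀ p ∈ simplex (G.U s), ∀ q ∈ simplex (G.W s),
      |∑ u ∈ G.U s, ∑ v ∈ G.W s, p u * q v * G.Aval V s u v| ≤ C := by
  refine ⟨‖G.Aval V s‖, fun p hp q hq => abs_bilinear_le hp hq fun u _ v _ => ?_⟩
  exact (norm_le_pi_norm (G.Aval V s u) v).trans (norm_le_pi_norm (G.Aval V s) u)

theorem T_le_T_add (V V' : S → ℝ) (s : S) : G.T V s ≤ G.T V' s + G.α * dist V V' := by
  obtain ⟨C, hC⟩ := G.exists_abs_bilinear_Aval_le V s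
  obtain ⟨C', hC'⟩ := G.exists_abs_bilinear_Aval_le V' s
  have hW := simplex_nonempty (G.W_nonempty s)
  refine sSup_le_sSup_add (simplex_nonempty (G.U_nonempty s)) ⟨C', fun p hp => ?_⟩
    fun p hp => sInf_le_sInf_add hW ⟨-C, fun q hq => (abs_le.1 (hC p hp q hq)).1⟩ fun q hq => ?_
  · obtain ⟨q, hq⟩ := hW
    refine le_trans (csInf_le ?_ ⟨q, hq, rfl⟩) (abs_le.1 (hC' p hp q hq)).2
    refine ⟨-C', ?_⟩
    rintro _ ⟨r, hr, rfl⟩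
    exact (abs_le.1 (hC' p hp r hr)).1
  · linarith [(abs_le.1 (G.abs_bilinear_Aval_sub_le V V' s hp hq)).2]

/-- The discount factor as a nonnegative real. -/
def discount : NNReal := ⟨G.α, G.α_pos.le⟩

theorem coe_discount : (G.discount : ℝ) = G.α := rfl

theorem lipschitzWith_T : LipschitzWith G.discount G.T := by
  refine LipschitzWith.of_dist_le_mul fun V V' => ?_
  rw [coe_discount, dist_pi_le_iff (mul_nonneg G.α_pos.le dist_nonneg)]
  intro s
  rw [Real.dist_eq, abs_le]
  have h := G.T_le_T_add V' V s
  rw [dist_comm] at h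
  constructor <;> linarith [G.T_le_T_add V V' s]

theorem contractingWith_Tpol {μ : S → A → ℝ} {ν : S → B → ℝ} (h : G.IsPolicy μ ν) :
    ContractingWith G.discount (G.Tpol μ ν) := by
  refine ⟨G.α_lt_one, LipschitzWith.of_dist_le_mul fun V V' => ?_⟩
  rw [coe_discount, dist_pi_le_iff (mul_nonneg G.α_pos.le dist_nonneg)]
  exact fun s => G.abs_bilinear_Aval_sub_le V V' s (h s).1 (h s).2

theorem dist_lookahead_step_le {m H : ℕ} (hH : 1 ≤ H) {V : S → ℝ} {μ : S → A → ℝ}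
    {ν : S → B → ℝ} (h : G.IsLookahead H μ ν V) {J : S → ℝ} (hJ : G.T J = J) :
    dist ((G.Tpol μ ν)^[m] (G.T^[H - 1] V)) J ≤
      (G.α ^ (H - 1) + (1 + G.α ^ m) * (G.α ^ (H - 1) / (1 - G.α)) * (1 + G.α)) *
        dist V J := by
  obtain ⟨hpol, hT⟩ := h
  obtain ⟨n, rfl⟩ := Nat.exists_eq_add_of_le' hH
  have hc := G.contractingWith_Tpol hpol
  rw [Nat.add_sub_cancel] at hT ⊢
  set x := G.T^[n] V
  have hα := G.α_pos
  have hα' : 0 < 1 - G.α := sub_pos.2 G.α_lt_one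
  have hxJ : dist x J ≤ G.α ^ n * dist V J := by
    have := (G.lipschitzWith_T.iterate n).dist_le_mul V J
    rwa [Function.iterate_fixed hJ, NNReal.coe_pow, coe_discount] at this
  have hTx : dist x (G.Tpol μ ν x) ≤ (1 + G.α) * dist x J := by
    have h1 := G.lipschitzWith_T.dist_le_mul x J
    rw [hJ, coe_discount] at h1
    rw [hT, Function.iterate_succ_apply']
    linarith [dist_triangle_right x (G.T x) J]
  have hm : dist ((G.Tpol μ ν)^[m] x) x ≤
      (1 + G.α ^ m) / (1 - G.α) * dist x (G.Tpol μ ν x) := by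
    have h1 := hc.dist_inequality x ((G.Tpol μ ν)^[m] x)
    have h2 := hc.toLipschitzWith.dist_iterate_succ_le_geometric x m
    rw [← Function.iterate_succ_apply' (G.Tpol μ ν), dist_comm, coe_discount] at h1
    rw [coe_discount] at h2
    refine h1.trans ?_
    rw [div_mul_eq_mul_div]
    gcongr
    linarith
  calc dist ((G.Tpol μ ν)^[m] x) J
      ≤ dist ((G.Tpol μ ν)^[m] x) x + dist x J := dist_triangle _ _ _
    _ ≤ (1 + G.α ^ m) / (1 - G.α) * ((1 + G.α) * dist x J) + dist x J := by
        gcongr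
        exact hm.trans (by gcongr)
    _ ≤ (1 + G.α ^ m) / (1 - G.α) * ((1 + G.α) * (G.α ^ n * dist V J)) +
          G.α ^ n * dist V J := by gcongr
    _ = _ := by ring

end MarkovGame

/-- Theorem 1, bound: For the iterates
`V_{k+1} = T_{μ_{k+1},ν_{k+1}}^m(T^{H−1}V_k)` where `(μ_{k+1},ν_{k+1})` is an
`H`-step lookahead policy for `V_k`,
`‖V_k − J*‖_∞ ≤ (α^{H−1} + (1+α^m)(α^{H−1}/(1−α))(1+α))^k ‖V_0 − J*‖_∞`. -/
theorem stmt_11 {S A B : Type*} [Fintype S] [Fintype A] [Fintype B]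
    (G : MarkovGame S A B) (m H : ℕ) (hm : 1 ≤ m) (hH : 1 ≤ H)
    (Vseq : ℕ → S → ℝ) (μ : ℕ → S → A → ℝ) (ν : ℕ → S → B → ℝ)
    (hLA : ∀ k, G.IsLookahead H (μ k) (ν k) (Vseq k))
    (hiter : ∀ k, Vseq (k + 1) = (G.Tpol (μ k) (ν k))^[m] (G.T^[H - 1] (Vseq k)))
    (Jstar : S → ℝ) (hJ : G.T Jstar = Jstar) :
    ∀ k, ‖Vseq k - Jstar‖ ≤
      (G.α ^ (H - 1) + (1 + G.α ^ m) * (G.α ^ (H - 1) / (1 - G.α)) * (1 + G.α)) ^ k *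
        ‖Vseq 0 - Jstar‖ := by
  intro k
  simp_rw [← dist_eq_norm]
  have hα := G.α_pos
  have hα' : 0 < 1 - G.α := sub_pos.2 G.α_lt_one
  induction k with
  | zero => simp
  | succ k ih =>
    rw [hiter k, pow_succ', mul_assoc]
    exact (G.dist_lookahead_step_le hH (hLA k) hJ).trans
      (mul_le_mul_of_nonneg_left ih (by positivity))
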